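/- There exists a constant C > 0 depending only on m (independent of ε, N, and the mesh) such that for every u ∈ ℝ^{N+1}, the Jacobian matrix H of T at u is invertible and ‖H^{−1}‖_∞ ≤ C. -/

import Mathlib

/-- `A(h) = (cosh(βh) − 1)/sinh(βh)`. -/
noncomputable def Acoef (β h : ℝ) : ℝ := (Real.cosh (β * h) - 1) / Real.sinh (β * h)

/-- `B(h) = (cosh(βh) + 1)/sinh(βh)`. -/
noncomputable def Bcoef (β h : ℝ) : ℝ := (Real.cosh (β * h) + 1) / Real.sinh (β * h)

/-- Entry `(i,j)` of the Jacobian matrix `H` of the discrete operator `T` at the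
point `u`, where `f'` denotes the partial derivative `∂f/∂y`, `x` are the mesh
points and `N+1` is the number of mesh points.  Rows `0` and `N` come from the
boundary equations `Tu_0 = -u_0`, `Tu_N = -u_N`; interior rows are obtained by
differentiating `Tu_i` with respect to `u_{i-1}, u_i, u_{i+1}`. -/
noncomputable def jacEntry (f' : ℝ → ℝ → ℝ) (γ β : ℝ) (x : ℕ → ℝ) (N : ℕ)
    (u : ℕ → ℝ) (i j : ℕ) : ℝ :=
  if i = 0 ∨ i = N then (if j = i then -1 else 0)
  else
    let h : ℕ → ℝ := fun k => x (k + 1) - x k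
    let D : ℝ := Acoef β (h (i - 1)) + Acoef β (h i)
    if j + 1 = i then
      γ / D * (Bcoef β (h (i - 1)) - f' (x (i - 1)) (u (i - 1)) * Acoef β (h (i - 1)) / γ)
    else if j = i then
      -(γ / D) * (Bcoef β (h (i - 1)) + Bcoef β (h i) + f' (x i) (u i) * D / γ)
    else if j = i + 1 then
      γ / D * (Bcoef β (h i) - f' (x (i + 1)) (u (i + 1)) * Acoef β (h i) / γ)
    else 0

/-- A strictly row diagonally dominant matrix with dominance gap at least `δ` is invertible and
the absolute row sums of its inverse are at most `δ⁻¹` (the Ahlberg–Nilson–Varah bound). -/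
theorem isUnit_and_sum_abs_inv_le_of_diag_dominant {n : Type*} [Fintype n] [DecidableEq n]
    (A : Matrix n n ℝ) {δ : ℝ} (hδ : 0 < δ)
    (hA : ∀ i, ∑ j ∈ Finset.univ.erase i, |A i j| + δ ≤ |A i i|) :
    IsUnit A ∧ ∀ i, ∑ j, |A⁻¹ i j| ≤ δ⁻¹ := by
  have hdet : IsUnit A.det := by
    refine isUnit_iff_ne_zero.2 (det_ne_zero_of_sum_row_lt_diag fun i => ?_)
    simp only [Real.norm_eq_abs]
    linarith [hA i]
  refine ⟨(Matrix.isUnit_iff_isUnit_det A).2 hdet, fun i => ?_⟩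
  let v : n → ℝ := fun j => SignType.sign (A⁻¹ i j)
  let w : n → ℝ := A⁻¹.mulVec v
  have hv : ∀ j, |v j| ≤ 1 := fun j => by
    rcases lt_trichotomy (A⁻¹ i j) 0 with h | h | h <;> simp [v, h]
  have hAw : A.mulVec w = v := by
    simp [w, Matrix.mulVec_mulVec, Matrix.mul_nonsing_inv A hdet]
  have hwi : w i = ∑ j, |A⁻¹ i j| := by
    simp [w, v, Matrix.mulVec, dotProduct, self_mul_sign]
  obtain ⟨k, -, hk⟩ := Finset.exists_max_image Finset.univ (fun j => |w j|) ⟨i, Finset.mem_univ i⟩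
  have hrow : A k k * w k = v k - ∑ j ∈ Finset.univ.erase k, A k j * w j := by
    rw [← hAw, Matrix.mulVec, dotProduct,
      ← Finset.add_sum_erase _ _ (Finset.mem_univ k)]
    ring
  have hoff : |∑ j ∈ Finset.univ.erase k, A k j * w j|
      ≤ (∑ j ∈ Finset.univ.erase k, |A k j|) * |w k| := by
    rw [Finset.sum_mul]
    refine (Finset.abs_sum_le_sum_abs _ _).trans (Finset.sum_le_sum fun j _ => ?_)
    rw [abs_mul]
    exact mul_le_mul_of_nonneg_left (hk j (Finset.mem_univ j)) (abs_nonneg _)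
  have hdiag : |A k k| * |w k| ≤ 1 + (∑ j ∈ Finset.univ.erase k, |A k j|) * |w k| := by
    rw [← abs_mul, hrow]
    exact (abs_sub _ _).trans (add_le_add (hv k) hoff)
  have hgap := mul_le_mul_of_nonneg_right (hA k) (abs_nonneg (w k))
  have hwk : |w k| ≤ δ⁻¹ := by
    rw [← one_div, le_div_iff₀ hδ]
    linarith
  exact hwi ▸ (le_abs_self _).trans ((hk i (Finset.mem_univ i)).trans hwk)

theorem Acoef_pos {β h : ℝ} (hβh : 0 < β * h) : 0 < Acoef β h :=
  div_pos (sub_pos.2 (Real.one_lt_cosh.2 hβh.ne')) (Real.sinh_pos_iff.2 hβh)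

theorem Acoef_le_Bcoef {β h : ℝ} (hβh : 0 < β * h) : Acoef β h ≤ Bcoef β h :=
  div_le_div_of_nonneg_right (by linarith) (Real.sinh_pos_iff.2 hβh).le

/-- Dominance gap of a row `γ / D * (B₁ - p * A₁ / γ)`, `-(γ / D) * (B₁ + B₂ + q * D / γ)`,
`γ / D * (B₂ - r * A₂ / γ)` with `D = A₁ + A₂`. -/
theorem abs_add_abs_add_le_abs_diag {m γ p q r A₁ A₂ B₁ B₂ : ℝ} (hm : 0 < m)
    (hp : m ≤ p) (hp' : p ≤ γ) (hq : m ≤ q) (hr : m ≤ r) (hr' : r ≤ γ)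
    (hA₁ : 0 < A₁) (hA₂ : 0 < A₂) (hAB₁ : A₁ ≤ B₁) (hAB₂ : A₂ ≤ B₂) :
    |γ / (A₁ + A₂) * (B₁ - p * A₁ / γ)| + |γ / (A₁ + A₂) * (B₂ - r * A₂ / γ)| + 2 * m
      ≤ |-(γ / (A₁ + A₂)) * (B₁ + B₂ + q * (A₁ + A₂) / γ)| := by
  have hγ : 0 < γ := by linarith
  have hD : 0 < A₁ + A₂ := by linarith
  have hoff : ∀ {s A B : ℝ}, s ≤ γ → 0 < A → A ≤ B →
      0 ≤ γ / (A₁ + A₂) * (B - s * A / γ) := fun {s A B} hs hA hAB => by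
    have : s * A / γ ≤ A := by
      rw [div_le_iff₀ hγ, mul_comm A]
      exact mul_le_mul_of_nonneg_right hs hA.le
    exact mul_nonneg (div_pos hγ hD).le (by linarith)
  have hq0 : 0 < q := by linarith
  have hdiag : 0 ≤ γ / (A₁ + A₂) * (B₁ + B₂ + q * (A₁ + A₂) / γ) :=
    mul_nonneg (div_pos hγ hD).le (by
      have : 0 < q * (A₁ + A₂) / γ := by positivity
      linarith)
  have key : m ≤ (p * A₁ + r * A₂) / (A₁ + A₂) := by
    rw [le_div_iff₀ hD]
    nlinarith
  have hsum : γ / (A₁ + A₂) * (B₁ + B₂ + q * (A₁ + A₂) / γ)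
      = γ / (A₁ + A₂) * (B₁ - p * A₁ / γ) + γ / (A₁ + A₂) * (B₂ - r * A₂ / γ)
        + (q + (p * A₁ + r * A₂) / (A₁ + A₂)) := by
    field_simp
    ring
  rw [neg_mul, abs_neg, abs_of_nonneg hdiag, abs_of_nonneg (hoff hp' hA₁ hAB₁),
    abs_of_nonneg (hoff hr' hA₂ hAB₂), hsum]
  linarith

/-- The off-diagonal absolute sum of an interior row `k + 1` has only the two neighbouring terms. -/
theorem sum_erase_abs_jacEntry (f' : ℝ → ℝ → ℝ) (γ β : ℝ) (x : ℕ → ℝ) {N k : ℕ} (u : ℕ → ℝ)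
    (hk : k + 1 < N) :
    ∑ j ∈ Finset.univ.erase (⟨k + 1, by omega⟩ : Fin (N + 1)),
        |jacEntry f' γ β x N u (k + 1) j.1|
      = |jacEntry f' γ β x N u (k + 1) k| + |jacEntry f' γ β x N u (k + 1) (k + 2)| := by
  rw [← Finset.sum_pair (f := fun j : Fin (N + 1) => |jacEntry f' γ β x N u (k + 1) j.1|)
    (a := ⟨k, by omega⟩) (b := ⟨k + 2, by omega⟩) (by simp)]
  symm
  refine Finset.sum_subset (fun j hj => ?_) fun j hj hj' => ?_
  · simp only [Finset.mem_insert, Finset.mem_singleton] at hj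
    rcases hj with rfl | rfl <;> simp
  · simp only [Finset.mem_insert, Finset.mem_singleton, Finset.mem_erase, Fin.ext_iff, not_or,
      Finset.mem_univ, and_true] at hj hj'
    have h1 : ¬(k + 1 = 0 ∨ k + 1 = N) := by omega
    have h2 : ¬(j.1 + 1 = k + 1) := by omega
    have h3 : ¬(j.1 = k + 1 + 1) := by omega
    have h4 : ¬(j.1 = k + 1) := fun h => hj (Fin.ext h)
    simp only [jacEntry, if_neg h1, if_neg h2, if_neg h4, if_neg h3, abs_zero]

/-- Every row of the Jacobian is diagonally dominant with gap at least `min 1 (2 * m)`. -/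
theorem jacEntry_diag_dominant {f' : ℝ → ℝ → ℝ} {m γ β : ℝ} {x u : ℕ → ℝ} {N : ℕ}
    (hm : 0 < m) (hβ : 0 < β)
    (hlow : ∀ i ≤ N, m ≤ f' (x i) (u i)) (hup : ∀ i ≤ N, f' (x i) (u i) ≤ γ)
    (hx : ∀ i < N, x i < x (i + 1)) (i : Fin (N + 1)) :
    ∑ j ∈ Finset.univ.erase i, |jacEntry f' γ β x N u i.1 j.1| + min 1 (2 * m)
      ≤ |jacEntry f' γ β x N u i.1 i.1| := by
  by_cases hi : i.1 = 0 ∨ i.1 = N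
  · rw [Finset.sum_eq_zero fun j hj => ?_]
    · simp only [jacEntry, if_pos hi]
      simp
    · have hji : j.1 ≠ i.1 := fun h => (Finset.mem_erase.1 hj).1 (Fin.ext h)
      simp only [jacEntry, if_pos hi, if_neg hji, abs_zero]
  obtain ⟨i, hiN⟩ := i
  obtain ⟨k, rfl⟩ : ∃ k, i = k + 1 := Nat.exists_eq_succ_of_ne_zero fun h => hi (Or.inl h)
  have hk : k + 1 < N := by
    simp only [not_or] at hi
    omega
  have hpos : ∀ j < N, 0 < β * (x (j + 1) - x j) := fun j hj =>
    mul_pos hβ (sub_pos.2 (hx j hj))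
  have hgap := abs_add_abs_add_le_abs_diag hm (hlow k (by omega)) (hup k (by omega))
    (hlow (k + 1) hk.le) (hlow (k + 2) hk) (hup (k + 2) hk)
    (Acoef_pos (hpos k (by omega))) (Acoef_pos (hpos (k + 1) hk))
    (Acoef_le_Bcoef (hpos k (by omega))) (Acoef_le_Bcoef (hpos (k + 1) hk))
  rw [sum_erase_abs_jacEntry f' γ β x u hk]
  refine (add_le_add_right (min_le_right _ _) _).trans ?_
  have hi' : ¬(k + 1 = 0 ∨ k + 1 = N) := hi
  simpa [jacEntry, hi', hk.ne] using hgap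

/-- There is a constant `C > 0` depending only on `m` such that for every `u`,
the Jacobian matrix `H` of the discrete operator `T` at `u` is invertible with
`‖H⁻¹‖_∞ ≤ C` (maximum row-sum norm). -/
theorem jacobian_inverse_bound (m : ℝ) (hm : 0 < m) :
    ∃ C > (0:ℝ),
      ∀ (ε γ β : ℝ) (N : ℕ) (f f' : ℝ → ℝ → ℝ) (x : ℕ → ℝ),
        0 < ε → ε < 1 →
        β = Real.sqrt γ / ε →
        (∀ a u : ℝ, HasDerivAt (f a) (f' a u) u) →
        (∀ a ∈ Set.Icc (0:ℝ) 1, ∀ u : ℝ, m ≤ f' a u) →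
        (∀ a ∈ Set.Icc (0:ℝ) 1, ∀ u : ℝ, f' a u ≤ γ) →
        2 ≤ N → x 0 = 0 → x N = 1 →
        (∀ i : ℕ, i < N → x i < x (i + 1)) →
        ∀ u : ℕ → ℝ,
          IsUnit (Matrix.of fun i j : Fin (N + 1) =>
            jacEntry f' γ β x N u i.1 j.1) ∧
          ∀ i : Fin (N + 1),
            ∑ j : Fin (N + 1),
              |(Matrix.of fun i j : Fin (N + 1) =>
                  jacEntry f' γ β x N u i.1 j.1)⁻¹ i j| ≤ C := by
  have hδ : 0 < min 1 (2 * m) := lt_min one_pos (by linarith)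
  refine ⟨(min 1 (2 * m))⁻¹, inv_pos.2 hδ, ?_⟩
  intro ε γ β N f f' x hε _ hβ _ hlow hup _ hx0 hxN hx u
  have hmono : ∀ i j, i ≤ j → j ≤ N → x i ≤ x j := fun i j hij hj => by
    induction j, hij using Nat.le_induction with
    | base => exact le_rfl
    | succ j _ ih => exact (ih (by omega)).trans (hx j (by omega)).le
  have hmem : ∀ i ≤ N, x i ∈ Set.Icc (0 : ℝ) 1 := fun i hi =>
    ⟨hx0 ▸ hmono 0 i (Nat.zero_le i) hi, hxN ▸ hmono i N hi le_rfl⟩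
  have hγ : 0 < γ := hm.trans_le
    ((hlow _ (hmem 0 (Nat.zero_le N)) 0).trans (hup _ (hmem 0 (Nat.zero_le N)) 0))
  have hβ0 : 0 < β := hβ ▸ div_pos (Real.sqrt_pos.2 hγ) hε
  exact isUnit_and_sum_abs_inv_le_of_diag_dominant _ hδ
    (jacEntry_diag_dominant hm hβ0 (fun i hi => hlow _ (hmem i hi) _)
      (fun i hi => hup _ (hmem i hi) _) hx)
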